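/- Fix integers T ≥ 1, t with 1 ≤ t ≤ T, H ≥ 1, integers N_F ≥ 1 and N_P ≥ 1 (the cardinalities of the reward and dynamics function classes), δ ∈ (0,1), and parameters β_r, β_P > 0. Let f_⋆, f̂_t : C × S × A → [0,1] be context-dependent reward functions, P_⋆ and P̂_t context-dependent dynamics, and π_1, …, π_{t−1} ∈ Π_C the policies used to define the bonuses b^R_t and b^P_t. Assume the two cumulative approximation-error bounds: (i) E_c[ Σ_{i=1}^{t−1} E_{π_i(c;·),P^c_⋆}[ Σ_{h=0}^{H−1} ( f̂_t(c,s_h,a_h) − f_⋆(c,s_h,a_h) )² | s_0 ] ] ≤ 68H · log(6T³N_F/δ), and (ii) E_c[ Σ_{i=1}^{t−1} E_{π_i(c;·),P^c_⋆}[ Σ_{h=0}^{H−1} D_H²(P^c_⋆(·|s_h,a_h), P̂^c_t(·|s_h,a_h)) | s_0 ] ] ≤ 2H · log(3THN_P/δ). Then for every context-dependent policy π ∈ Π_C: | E_c[ V^{π(c;·)}_{M^{(f_⋆,P_⋆)}(c)}(s_0) − V^{π(c;·)}_{M^{(f̂_t,P̂_t)}(c)}(s_0) ] | ≤ (112H³/β_r)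 · log(18T⁴H·N_F·N_P/δ²) + (157H⁴/β_P) · log(3TH·N_P/δ) + E_c[ Σ_{h=0}^{H−1} Σ_{s∈S_h} Σ_{a∈A} q_h(s,a|π(c;·),P̂^c_t) · ( b^R_t(c,s,a) + b^P_t(c,s,a) ) ]. -/

import Mathlib

open scoped BigOperators Classical
open Finset

noncomputable section

/-- Squared Hellinger distance between two distributions on a finite set. -/
def hellingerSq {X : Type*} [Fintype X] (P Q : X → ℝ) : ℝ :=
  ∑ x, (Real.sqrt (P x) - Real.sqrt (Q x)) ^ 2

variable {S : ℕ → Type} [∀ h, Fintype (S h)] {A : Type} [Fintype A]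

/-- Value function of a deterministic policy in a layered MDP, defined by the backward
Bellman recursion: `val P r pol k h s` is the value with `k` steps to go, starting at
state `s` in layer `h`.  The layer-`h` value function of the horizon-`H` MDP is
`val P r pol (H - h) h`. -/
def val (P : ∀ h, S h → A → S (h + 1) → ℝ) (r : ∀ h, S h → A → ℝ)
    (pol : ∀ h, S h → A) : (k : ℕ) → (h : ℕ) → S h → ℝ
  | 0, _, _ => 0
  | k + 1, h, s =>
      r h s (pol h s) + ∑ s' : S (h + 1), P h s (pol h s) s' * val P r pol k (h + 1) s'

/-- State-occupancy measure: `stateOcc P pol h0 st k s` is the probability of being at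
state `s` in layer `h0 + k` when acting with the deterministic policy `pol` under
dynamics `P`, starting from state `st` in layer `h0`. -/
def stateOcc (P : ∀ h, S h → A → S (h + 1) → ℝ) (pol : ∀ h, S h → A)
    (h0 : ℕ) (st : S h0) : (k : ℕ) → S (h0 + k) → ℝ
  | 0, s => if s = st then 1 else 0
  | k + 1, s' =>
      ∑ s : S (h0 + k), stateOcc P pol h0 st k s * P (h0 + k) s (pol (h0 + k) s) s'

/-- State-action occupancy measure started at `st` in layer `h0`. -/
def occ (P : ∀ h, S h → A → S (h + 1) → ℝ) (pol : ∀ h, S h → A)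
    (h0 : ℕ) (st : S h0) (k : ℕ) (s : S (h0 + k)) (a : A) : ℝ :=
  if a = pol (h0 + k) s then stateOcc P pol h0 st k s else 0

/-- State-occupancy measure started from the initial state `s0` of layer `0`:
probability of being at state `s` in layer `h`. -/
def stateOcc0 (P : ∀ h, S h → A → S (h + 1) → ℝ) (pol : ∀ h, S h → A)
    (s0 : S 0) : (h : ℕ) → S h → ℝ
  | 0, s => if s = s0 then 1 else 0
  | h + 1, s' => ∑ s : S h, stateOcc0 P pol s0 h s * P h s (pol h s) s'

/-- State-action occupancy measure `q_h(s, a | pol, P)` started from the initial state. -/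
def occ0 (P : ∀ h, S h → A → S (h + 1) → ℝ) (pol : ∀ h, S h → A)
    (s0 : S 0) (h : ℕ) (s : S h) (a : A) : ℝ :=
  if a = pol h s then stateOcc0 P pol s0 h s else 0


variable {C : Type} [Fintype C]

/-- Reward bonus `b^R_t(c,s,a)` built from the past policies `pols 0, …, pols (t-2)`
(representing `π_1, …, π_{t-1}`) and the approximated dynamics `Phat`. -/
def bonusR (Phat : C → ∀ h, S h → A → S (h + 1) → ℝ)
    (pols : ℕ → C → ∀ h, S h → A) (s0 : S 0) (t : ℕ) (br : ℝ)
    (c : C) (h : ℕ) (s : S h) (a : A) : ℝ :=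
  min 1 ((br / 2) / (1 + ∑ i ∈ Finset.range (t - 1), occ0 (Phat c) (pols i c) s0 h s a))

/-- Reward bonus `b^P_t(c,s,a)` built from the past policies `pols 0, …, pols (t-2)`
(representing `π_1, …, π_{t-1}`) and the approximated dynamics `Phat`. -/
def bonusP (Phat : C → ∀ h, S h → A → S (h + 1) → ℝ)
    (pols : ℕ → C → ∀ h, S h → A) (s0 : S 0) (t : ℕ) (bp : ℝ) (H : ℕ)
    (c : C) (h : ℕ) (s : S h) (a : A) : ℝ :=
  min (H : ℝ)
    ((bp * H / 2) / (1 + ∑ i ∈ Finset.range (t - 1), occ0 (Phat c) (pols i c) s0 h s a))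

section LayeredMDP

omit [Fintype A]

variable {P Q : ∀ h, S h → A → S (h + 1) → ℝ} {H : ℕ}

theorem hellingerSq_nonneg {X : Type*} [Fintype X] (p q : X → ℝ) : 0 ≤ hellingerSq p q :=
  Finset.sum_nonneg fun _ _ => sq_nonneg _

theorem hellingerSq_le_two {X : Type*} [Fintype X] {p q : X → ℝ}
    (hp : ∀ x, 0 ≤ p x) (hq : ∀ x, 0 ≤ q x) (hp1 : ∑ x, p x = 1) (hq1 : ∑ x, q x = 1) :
    hellingerSq p q ≤ 2 := by
  have h : hellingerSq p q ≤ ∑ x, (p x + q x) := by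
    refine Finset.sum_le_sum fun x _ => ?_
    have h1 := Real.sq_sqrt (hp x)
    have h2 := Real.sq_sqrt (hq x)
    nlinarith [mul_nonneg (Real.sqrt_nonneg (p x)) (Real.sqrt_nonneg (q x))]
  rw [Finset.sum_add_distrib, hp1, hq1] at h
  linarith

/-- Bounded functions have expectations under `p` and `q` differing by at most the Hellinger
distance times the length of their range. -/
theorem sq_sum_sub_mul_le_hellingerSq {X : Type*} [Fintype X] {p q : X → ℝ}
    (hp : ∀ x, 0 ≤ p x) (hq : ∀ x, 0 ≤ q x) (hp1 : ∑ x, p x = 1) (hq1 : ∑ x, q x = 1)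
    {V : X → ℝ} {M : ℝ} (hV0 : ∀ x, 0 ≤ V x) (hVM : ∀ x, V x ≤ M) :
    (∑ x, (p x - q x) * V x) ^ 2 ≤ M ^ 2 * hellingerSq p q := by
  have hcenter : ∑ x, (p x - q x) * V x =
      ∑ x, (Real.sqrt (p x) - Real.sqrt (q x)) *
        ((Real.sqrt (p x) + Real.sqrt (q x)) * (V x - M / 2)) := by
    have h0 : ∑ x, (p x - q x) * (M / 2) = 0 := by
      rw [← Finset.sum_mul, Finset.sum_sub_distrib, hp1, hq1]; ring
    have h1 : ∑ x, (p x - q x) * V x = ∑ x, (p x - q x) * (V x - M / 2) := by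
      simp only [mul_sub, Finset.sum_sub_distrib] at h0 ⊢
      linarith
    rw [h1]
    refine Finset.sum_congr rfl fun x _ => ?_
    conv_lhs => rw [← Real.sq_sqrt (hp x), ← Real.sq_sqrt (hq x)]
    ring
  have hbound : ∑ x, ((Real.sqrt (p x) + Real.sqrt (q x)) * (V x - M / 2)) ^ 2 ≤ M ^ 2 := by
    have : ∀ x, ((Real.sqrt (p x) + Real.sqrt (q x)) * (V x - M / 2)) ^ 2 ≤
        M ^ 2 / 2 * (p x + q x) := by
      intro x
      have h1 : (Real.sqrt (p x) + Real.sqrt (q x)) ^ 2 ≤ 2 * (p x + q x) := by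
        nlinarith [sq_nonneg (Real.sqrt (p x) - Real.sqrt (q x)), Real.sq_sqrt (hp x),
          Real.sq_sqrt (hq x)]
      have h2 : (V x - M / 2) ^ 2 ≤ M ^ 2 / 4 := by nlinarith [hV0 x, hVM x]
      rw [mul_pow]
      calc _ ≤ 2 * (p x + q x) * (M ^ 2 / 4) :=
            mul_le_mul h1 h2 (sq_nonneg _) (by linarith [hp x, hq x])
        _ = _ := by ring
    calc _ ≤ ∑ x, M ^ 2 / 2 * (p x + q x) := Finset.sum_le_sum fun x _ => this x
      _ = M ^ 2 := by rw [← Finset.mul_sum, Finset.sum_add_distrib, hp1, hq1]; ring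
  rw [hcenter]
  refine (Finset.sum_mul_sq_le_sq_mul_sq _ _ _).trans ?_
  rw [mul_comm (M ^ 2)]
  exact mul_le_mul_of_nonneg_left hbound (hellingerSq_nonneg p q)

theorem abs_sum_sub_mul_le {X : Type*} [Fintype X] {p q : X → ℝ}
    (hp : ∀ x, 0 ≤ p x) (hq : ∀ x, 0 ≤ q x) (hp1 : ∑ x, p x = 1) (hq1 : ∑ x, q x = 1)
    {V : X → ℝ} {M : ℝ} (hV0 : ∀ x, 0 ≤ V x) (hVM : ∀ x, V x ≤ M) :
    |∑ x, (p x - q x) * V x| ≤ M := by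
  have key : ∀ r : X → ℝ, (∀ x, 0 ≤ r x) → ∑ x, r x = 1 →
      0 ≤ ∑ x, r x * V x ∧ ∑ x, r x * V x ≤ M := fun r hr hr1 =>
    ⟨Finset.sum_nonneg fun x _ => mul_nonneg (hr x) (hV0 x), by
      calc _ ≤ ∑ x, r x * M :=
            Finset.sum_le_sum fun x _ => mul_le_mul_of_nonneg_left (hVM x) (hr x)
        _ = M := by rw [← Finset.sum_mul, hr1, one_mul]⟩
  have h1 := key p hp hp1
  have h2 := key q hq hq1
  simp only [sub_mul, Finset.sum_sub_distrib]
  rw [abs_le]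
  constructor <;> linarith [h1.1, h1.2, h2.1, h2.2]

/-- Multiplicative change of measure for bounded nonnegative functions. -/
theorem sum_mul_le_add_hellingerSq {X : Type*} [Fintype X] {p q : X → ℝ}
    (hp : ∀ x, 0 ≤ p x) (hq : ∀ x, 0 ≤ q x) {V : X → ℝ} {M η : ℝ} (hη : 0 < η)
    (hV0 : ∀ x, 0 ≤ V x) (hVM : ∀ x, V x ≤ M) :
    ∑ x, q x * V x ≤ (1 + η) * ∑ x, p x * V x + (1 + 1 / η) * M * hellingerSq p q := by
  unfold hellingerSq
  rw [Finset.mul_sum, Finset.mul_sum, ← Finset.sum_add_distrib]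
  refine Finset.sum_le_sum fun x _ => ?_
  set a := Real.sqrt (p x)
  set b := Real.sqrt (q x)
  have ha : p x = a ^ 2 := (Real.sq_sqrt (hp x)).symm
  have hb : q x = b ^ 2 := (Real.sq_sqrt (hq x)).symm
  have h1 : q x ≤ (1 + η) * p x + (1 + 1 / η) * (a - b) ^ 2 := by
    have : (1 + η) * a ^ 2 + (1 + 1 / η) * (a - b) ^ 2 - b ^ 2 =
        (η * a + (a - b)) ^ 2 / η := by
      field_simp
      ring
    have h2 : 0 ≤ (η * a + (a - b)) ^ 2 / η := by positivity
    rw [ha, hb]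
    linarith
  calc q x * V x ≤ ((1 + η) * p x + (1 + 1 / η) * (a - b) ^ 2) * V x :=
        mul_le_mul_of_nonneg_right h1 (hV0 x)
    _ = (1 + η) * (p x * V x) + (1 + 1 / η) * (a - b) ^ 2 * V x := by ring
    _ ≤ (1 + η) * (p x * V x) + (1 + 1 / η) * (a - b) ^ 2 * M := by
        have : 0 ≤ (1 + 1 / η) * (a - b) ^ 2 := by positivity
        linarith [mul_le_mul_of_nonneg_left (hVM x) this]
    _ = _ := by ring

theorem val_add (r r' : ∀ h, S h → A → ℝ) (pol : ∀ h, S h → A) (k h : ℕ) (s : S h) :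
    val P (fun h s a => r h s a + r' h s a) pol k h s =
      val P r pol k h s + val P r' pol k h s := by
  induction k generalizing h with
  | zero => simp [_root_.val]
  | succ k ih =>
    simp only [_root_.val, ih, mul_add, Finset.sum_add_distrib]
    ring

theorem val_const_mul (x : ℝ) (r : ∀ h, S h → A → ℝ) (pol : ∀ h, S h → A) (k h : ℕ) (s : S h) :
    val P (fun h s a => x * r h s a) pol k h s = x * val P r pol k h s := by
  induction k generalizing h with
  | zero => simp [_root_.val]
  | succ k ih =>
    simp only [_root_.val, ih, mul_add, Finset.mul_sum]
    congr 1
    exact Finset.sum_congr rfl fun _ _ => by ring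

theorem val_mono (hP : ∀ h, h < H → ∀ s a s', 0 ≤ P h s a s') {r r' : ∀ h, S h → A → ℝ}
    (hr : ∀ h, h < H → ∀ s a, r h s a ≤ r' h s a) (pol : ∀ h, S h → A) (k h : ℕ) (s : S h)
    (hk : h + k ≤ H) : val P r pol k h s ≤ val P r' pol k h s := by
  induction k generalizing h with
  | zero => simp [_root_.val]
  | succ k ih =>
    simp only [_root_.val]
    refine add_le_add (hr h (by omega) _ _) (Finset.sum_le_sum fun s' _ => ?_)
    exact mul_le_mul_of_nonneg_left (ih _ _ (by omega)) (hP h (by omega) _ _ _)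

theorem val_const (hP1 : ∀ h, h < H → ∀ s a, ∑ s', P h s a s' = 1) (B : ℝ)
    (pol : ∀ h, S h → A) (k h : ℕ) (s : S h) (hk : h + k ≤ H) :
    val P (fun _ _ _ => B) pol k h s = k * B := by
  induction k generalizing h with
  | zero => simp [_root_.val]
  | succ k ih =>
    simp only [_root_.val]
    rw [Finset.sum_congr rfl fun s' _ => by rw [ih _ s' (by omega)], ← Finset.sum_mul,
      hP1 h (by omega)]
    push_cast
    ring

theorem val_nonneg (hP : ∀ h, h < H → ∀ s a s', 0 ≤ P h s a s')
    (hP1 : ∀ h, h < H → ∀ s a, ∑ s', P h s a s' = 1) {r : ∀ h, S h → A → ℝ}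
    (hr : ∀ h, h < H → ∀ s a, 0 ≤ r h s a) (pol : ∀ h, S h → A) (k h : ℕ) (s : S h)
    (hk : h + k ≤ H) : 0 ≤ val P r pol k h s := by
  have h1 := val_mono (r := fun _ _ _ => 0) hP hr pol k h s hk
  rwa [val_const hP1 0 pol k h s hk, mul_zero] at h1

theorem val_le (hP : ∀ h, h < H → ∀ s a s', 0 ≤ P h s a s')
    (hP1 : ∀ h, h < H → ∀ s a, ∑ s', P h s a s' = 1) {r : ∀ h, S h → A → ℝ} {B : ℝ}
    (hB : 0 ≤ B) (hr : ∀ h, h < H → ∀ s a, r h s a ≤ B) (pol : ∀ h, S h → A) (k h : ℕ) (s : S h)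
    (hk : h + k ≤ H) : val P r pol k h s ≤ H * B := by
  have h1 := val_mono (r' := fun _ _ _ => B) hP hr pol k h s hk
  rw [val_const hP1 B pol k h s hk] at h1
  have h2 : (k : ℝ) ≤ H := by exact_mod_cast (by omega : k ≤ H)
  exact h1.trans (mul_le_mul_of_nonneg_right h2 hB)

theorem sum_occ0_mul [Fintype A] (pol : ∀ h, S h → A) (s0 : S 0) (h : ℕ) (s : S h) (g : A → ℝ) :
    ∑ a, occ0 P pol s0 h s a * g a = stateOcc0 P pol s0 h s * g (pol h s) := by
  simp [occ0, ite_mul]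

/-- The value at the initial state is the occupancy-weighted sum of rewards. -/
theorem sum_occ0_mul_eq_val [Fintype A] (r : ∀ h, S h → A → ℝ) (pol : ∀ h, S h → A) (s0 : S 0) (n : ℕ) :
    ∑ h ∈ Finset.range n, ∑ s : S h, ∑ a : A, occ0 P pol s0 h s a * r h s a =
      val P r pol n 0 s0 := by
  have key : ∀ n k : ℕ, val P r pol (n + k) 0 s0 =
      (∑ h ∈ Finset.range n, ∑ s : S h, stateOcc0 P pol s0 h s * r h s (pol h s)) +
        ∑ s : S n, stateOcc0 P pol s0 n s * val P r pol k n s := by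
    intro n
    induction n with
    | zero => intro k; simp [stateOcc0]
    | succ n ih =>
      intro k
      rw [show n + 1 + k = n + (k + 1) by ring, ih, Finset.sum_range_succ, add_assoc]
      congr 1
      simp only [_root_.val, mul_add, Finset.sum_add_distrib, stateOcc0, Finset.sum_mul, Finset.mul_sum]
      rw [Finset.sum_comm (s := (Finset.univ : Finset (S (n + 1))))]
      simp only [mul_assoc]
  simp only [fun h s => sum_occ0_mul (P := P) pol s0 h s (r h s)]
  have := key n 0
  simpa [_root_.val] using this.symm

theorem stateOcc0_nonneg (hP : ∀ h, h < H → ∀ s a s', 0 ≤ P h s a s')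
    (pol : ∀ h, S h → A) (s0 : S 0) (h : ℕ) (hh : h ≤ H) (s : S h) :
    0 ≤ stateOcc0 P pol s0 h s := by
  induction h with
  | zero => simp only [stateOcc0]; split_ifs <;> norm_num
  | succ h ih =>
    exact Finset.sum_nonneg fun s' _ => mul_nonneg (ih (by omega) s') (hP h (by omega) _ _ _)

theorem sum_stateOcc0 (hP1 : ∀ h, h < H → ∀ s a, ∑ s', P h s a s' = 1)
    (pol : ∀ h, S h → A) (s0 : S 0) (h : ℕ) (hh : h ≤ H) :
    ∑ s, stateOcc0 P pol s0 h s = 1 := by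
  induction h with
  | zero => simp [stateOcc0]
  | succ h ih =>
    simp only [stateOcc0]
    rw [Finset.sum_comm]
    simp only [← Finset.mul_sum, fun s => hP1 h (by omega) s (pol h s), mul_one]
    exact ih (by omega)

theorem occ0_nonneg (hP : ∀ h, h < H → ∀ s a s', 0 ≤ P h s a s')
    (pol : ∀ h, S h → A) (s0 : S 0) (h : ℕ) (hh : h ≤ H) (s : S h) (a : A) :
    0 ≤ occ0 P pol s0 h s a := by
  unfold occ0
  split_ifs
  exacts [stateOcc0_nonneg hP pol s0 h hh s, le_rfl]

theorem occ0_le_one (hP : ∀ h, h < H → ∀ s a s', 0 ≤ P h s a s')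
    (hP1 : ∀ h, h < H → ∀ s a, ∑ s', P h s a s' = 1)
    (pol : ∀ h, S h → A) (s0 : S 0) (h : ℕ) (hh : h ≤ H) (s : S h) (a : A) :
    occ0 P pol s0 h s a ≤ 1 := by
  unfold occ0
  split_ifs
  · rw [← sum_stateOcc0 hP1 pol s0 h hh]
    exact Finset.single_le_sum (fun s _ => stateOcc0_nonneg hP pol s0 h hh s) (Finset.mem_univ s)
  · exact zero_le_one

/-- Multiplicative change of measure between the values of two dynamics. -/
theorem val_le_pow_mul_val_add_hellingerSq (hH : 1 ≤ H)
    (hP : ∀ h, h < H → ∀ s a s', 0 ≤ P h s a s')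
    (hQ : ∀ h, h < H → ∀ s a s', 0 ≤ Q h s a s')
    (hQ1 : ∀ h, h < H → ∀ s a, ∑ s', Q h s a s' = 1)
    {g : ∀ h, S h → A → ℝ} {B : ℝ} (hg0 : ∀ h, h < H → ∀ s a, 0 ≤ g h s a)
    (hgB : ∀ h, h < H → ∀ s a, g h s a ≤ B) (hB : 0 ≤ B)
    (pol : ∀ h, S h → A) (k h : ℕ) (s : S h) (hk : h + k ≤ H) :
    val Q g pol k h s ≤ (1 + 1 / (H : ℝ)) ^ k *
      val P (fun h s a => g h s a + 2 * B * (H : ℝ) ^ 2 * hellingerSq (P h s a) (Q h s a))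
        pol k h s := by
  have hH' : (1 : ℝ) ≤ H := by exact_mod_cast hH
  induction k generalizing h with
  | zero => simp [_root_.val]
  | succ k ih =>
    set G : ∀ h, S h → A → ℝ := fun h s a =>
      g h s a + 2 * B * (H : ℝ) ^ 2 * hellingerSq (P h s a) (Q h s a) with hG
    set η : ℝ := 1 / (H : ℝ) with hη
    have hη0 : 0 < η := by positivity
    have hh : h < H := by omega
    set a := pol h s
    have hone : (1 : ℝ) ≤ (1 + η) ^ (k + 1) := one_le_pow₀ (by linarith)
    have hG0 : 0 ≤ G h s a := by
      have := hg0 h hh s a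
      have := hellingerSq_nonneg (P h s a) (Q h s a)
      simp only [hG]
      positivity
    have hstep := sum_mul_le_add_hellingerSq (hP h hh s a) (hQ h hh s a)
      (V := fun s' => val Q g pol k (h + 1) s') (M := H * B) hη0
      (fun s' => val_nonneg hQ hQ1 hg0 pol k _ s' (by omega))
      (fun s' => val_le hQ hQ1 hB hgB pol k _ s' (by omega))
    have hcoef : (1 + 1 / η) * (H * B) ≤ 2 * B * (H : ℝ) ^ 2 := by
      rw [hη, one_div_one_div]
      nlinarith [mul_nonneg hB (mul_nonneg (by linarith) (by linarith) : (0 : ℝ) ≤ H * (H - 1))]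
    have hcoef' := mul_le_mul_of_nonneg_right hcoef (hellingerSq_nonneg (P h s a) (Q h s a))
    have hrec : ∑ s', P h s a s' * val Q g pol k (h + 1) s' ≤
        (1 + η) ^ k * ∑ s', P h s a s' * val P G pol k (h + 1) s' := by
      rw [Finset.mul_sum]
      refine Finset.sum_le_sum fun s' _ => ?_
      calc _ ≤ P h s a s' * ((1 + η) ^ k * val P G pol k (h + 1) s') :=
            mul_le_mul_of_nonneg_left (ih _ s' (by omega)) (hP h hh s a s')
        _ = _ := by ring
    have hrec' := mul_le_mul_of_nonneg_left hrec (by linarith : 0 ≤ 1 + η)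
    have hGone := mul_le_mul_of_nonneg_right hone hG0
    calc val Q g pol (k + 1) h s
        = g h s a + ∑ s', Q h s a s' * val Q g pol k (h + 1) s' := rfl
      _ ≤ G h s a + (1 + η) * ((1 + η) ^ k * ∑ s', P h s a s' * val P G pol k (h + 1) s') := by
          simp only [hG] at hrec' ⊢
          linarith
      _ ≤ (1 + η) ^ (k + 1) * (G h s a + ∑ s', P h s a s' * val P G pol k (h + 1) s') := by
          rw [pow_succ] at hGone ⊢
          linarith

theorem one_add_one_div_pow_le_three (hH : 1 ≤ H) : (1 + 1 / (H : ℝ)) ^ H ≤ 3 := by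
  have hH' : (0 : ℝ) < H := by exact_mod_cast hH
  have h1 : 1 + 1 / (H : ℝ) ≤ Real.exp (1 / H) := by
    linarith [Real.add_one_le_exp (1 / (H : ℝ))]
  calc (1 + 1 / (H : ℝ)) ^ H ≤ Real.exp (1 / H) ^ H := pow_le_pow_left₀ (by positivity) h1 H
    _ = Real.exp 1 := by rw [← Real.exp_nat_mul]; congr 1; field_simp
    _ ≤ 3 := by linarith [Real.exp_one_lt_d9]

theorem val_le_three_mul_val_add (hH : 1 ≤ H)
    (hP : ∀ h, h < H → ∀ s a s', 0 ≤ P h s a s')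
    (hQ : ∀ h, h < H → ∀ s a s', 0 ≤ Q h s a s')
    (hP1 : ∀ h, h < H → ∀ s a, ∑ s', P h s a s' = 1)
    (hQ1 : ∀ h, h < H → ∀ s a, ∑ s', Q h s a s' = 1)
    {g : ∀ h, S h → A → ℝ} {B : ℝ} (hg0 : ∀ h, h < H → ∀ s a, 0 ≤ g h s a)
    (hgB : ∀ h, h < H → ∀ s a, g h s a ≤ B) (hB : 0 ≤ B) (pol : ∀ h, S h → A) (s0 : S 0) :
    val Q g pol H 0 s0 ≤ 3 * val P g pol H 0 s0 + 6 * B * (H : ℝ) ^ 2 *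
      val P (fun h s a => hellingerSq (P h s a) (Q h s a)) pol H 0 s0 := by
  have h1 := val_le_pow_mul_val_add_hellingerSq hH hP hQ hQ1 hg0 hgB hB pol H 0 s0 (by omega)
  rw [val_add, val_const_mul] at h1
  have h2 : 0 ≤ val P g pol H 0 s0 := val_nonneg hP hP1 hg0 pol H 0 s0 (by omega)
  have h3 : 0 ≤ val P (fun h s a => hellingerSq (P h s a) (Q h s a)) pol H 0 s0 :=
    val_nonneg hP hP1 (fun _ _ _ _ => hellingerSq_nonneg _ _) pol H 0 s0 (by omega)
  have h4 := mul_le_mul_of_nonneg_right (one_add_one_div_pow_le_three hH)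
    (by positivity : 0 ≤ val P g pol H 0 s0 + 2 * B * (H : ℝ) ^ 2 *
      val P (fun h s a => hellingerSq (P h s a) (Q h s a)) pol H 0 s0)
  linarith

/-- Value-difference bound: the gap between two values is at most the value, under the second
dynamics, of the per-step reward and transition gaps. -/
theorem abs_val_sub_val_le (hP : ∀ h, h < H → ∀ s a s', 0 ≤ P h s a s')
    (hQ : ∀ h, h < H → ∀ s a s', 0 ≤ Q h s a s')
    (hP1 : ∀ h, h < H → ∀ s a, ∑ s', P h s a s' = 1)
    (hQ1 : ∀ h, h < H → ∀ s a, ∑ s', Q h s a s' = 1)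
    {f g : ∀ h, S h → A → ℝ} (hf : ∀ h s a, 0 ≤ f h s a ∧ f h s a ≤ 1)
    (pol : ∀ h, S h → A) (k h : ℕ) (s : S h) (hk : h + k ≤ H) :
    |val P f pol k h s - val Q g pol k h s| ≤
      val Q (fun h s a => |f h s a - g h s a| +
        H * min 1 (Real.sqrt (hellingerSq (P h s a) (Q h s a)))) pol k h s := by
  induction k generalizing h with
  | zero => simp [_root_.val]
  | succ k ih =>
    have hh : h < H := by omega
    set a := pol h s
    have hV0 : ∀ s', 0 ≤ val P f pol k (h + 1) s' := fun s' =>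
      val_nonneg hP hP1 (fun h _ s a => (hf h s a).1) pol k _ s' (by omega)
    have hVH : ∀ s', val P f pol k (h + 1) s' ≤ H := fun s' => by
      simpa using val_le hP hP1 zero_le_one (fun h _ s a => (hf h s a).2) pol k _ s' (by omega)
    have hsplit : val P f pol (k + 1) h s - val Q g pol (k + 1) h s =
        (f h s a - g h s a) + ∑ s', (P h s a s' - Q h s a s') * val P f pol k (h + 1) s' +
          ∑ s', Q h s a s' * (val P f pol k (h + 1) s' - val Q g pol k (h + 1) s') := by
      simp only [_root_.val, sub_mul, mul_sub, Finset.sum_sub_distrib, a]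
      ring
    have hdyn : |∑ s', (P h s a s' - Q h s a s') * val P f pol k (h + 1) s'| ≤
        H * min 1 (Real.sqrt (hellingerSq (P h s a) (Q h s a))) := by
      have h1 := abs_sum_sub_mul_le (hP h hh s a) (hQ h hh s a) (hP1 h hh s a) (hQ1 h hh s a)
        hV0 hVH
      have h2 := sq_sum_sub_mul_le_hellingerSq (hP h hh s a) (hQ h hh s a) (hP1 h hh s a)
        (hQ1 h hh s a) hV0 hVH
      have h3 := Real.abs_le_sqrt h2
      rw [Real.sqrt_mul (sq_nonneg _), Real.sqrt_sq (Nat.cast_nonneg H)] at h3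
      rcases min_cases 1 (Real.sqrt (hellingerSq (P h s a) (Q h s a))) with ⟨he, _⟩ | ⟨he, _⟩
      · rw [he, mul_one]; exact h1
      · rw [he]; exact h3
    rw [hsplit]
    refine (abs_add_le _ _).trans (add_le_add ((abs_add_le _ _).trans ?_) ?_)
    · exact add_le_add le_rfl hdyn
    · refine (Finset.abs_sum_le_sum_abs _ _).trans (Finset.sum_le_sum fun s' _ => ?_)
      rw [abs_mul, abs_of_nonneg (hQ h hh s a s')]
      exact mul_le_mul_of_nonneg_left (ih _ s' (by omega)) (hQ h hh s a s')

/-- AM-GM with truncation at the trivial bound `1`. -/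
theorem le_min_one_add {x β w : ℝ} (hx1 : x ≤ 1) (hβ : 0 < β) (hw : 0 < w) :
    x ≤ min 1 (β / 2 / w) + 1 / (2 * β) * (w * x ^ 2) := by
  have h0 : 0 ≤ 1 / (2 * β) * (w * x ^ 2) := by positivity
  have h1 : x ≤ β / 2 / w + 1 / (2 * β) * (w * x ^ 2) := by
    have : β / 2 / w + 1 / (2 * β) * (w * x ^ 2) - x = (β - w * x) ^ 2 / (2 * β * w) := by
      field_simp
      ring
    have h2 : 0 ≤ (β - w * x) ^ 2 / (2 * β * w) := by positivity
    linarith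
  rcases min_cases 1 (β / 2 / w) with ⟨he, _⟩ | ⟨he, _⟩ <;> rw [he] <;> linarith

/-- Weighting by one plus the past occupancies costs at most the sum of the past values. -/
theorem val_one_add_sum_occ0_mul_le [Fintype A] (hQ : ∀ h, h < H → ∀ s a s', 0 ≤ Q h s a s')
    (hQ1 : ∀ h, h < H → ∀ s a, ∑ s', Q h s a s' = 1)
    {g : ∀ h, S h → A → ℝ} {B : ℝ} (hg0 : ∀ h, h < H → ∀ s a, 0 ≤ g h s a)
    (hgB : ∀ h, h < H → ∀ s a, g h s a ≤ B) (hB : 0 ≤ B)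
    (pol : ∀ h, S h → A) (I : Finset ℕ) (pols : ℕ → ∀ h, S h → A) (s0 : S 0) :
    val Q (fun h s a => (1 + ∑ i ∈ I, occ0 Q (pols i) s0 h s a) * g h s a) pol H 0 s0 ≤
      H * B + ∑ i ∈ I, val Q g (pols i) H 0 s0 := by
  simp only [add_mul, one_mul]
  rw [val_add]
  refine add_le_add (val_le hQ hQ1 hB hgB pol H 0 s0 (by omega)) ?_
  simp only [← sum_occ0_mul_eq_val]
  conv_rhs => rw [Finset.sum_comm]
  refine Finset.sum_le_sum fun h hh => ?_
  have hh' := Finset.mem_range.1 hh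
  conv_rhs => rw [Finset.sum_comm]
  refine Finset.sum_le_sum fun s _ => ?_
  conv_rhs => rw [Finset.sum_comm]
  refine Finset.sum_le_sum fun a _ => ?_
  rw [← Finset.sum_mul]
  exact mul_le_of_le_one_left
    (mul_nonneg (Finset.sum_nonneg fun i _ => occ0_nonneg hQ _ s0 h hh'.le s a) (hg0 h hh' s a))
    (occ0_le_one hQ hQ1 pol s0 h hh'.le s a)

/-- Value gap at a single context, in terms of the bonuses and of the cumulative
approximation errors of the past policies under the true dynamics. -/
theorem abs_val_sub_val_le_bonus [Fintype A] (hH : 1 ≤ H)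
    (hP : ∀ h, h < H → ∀ s a s', 0 ≤ P h s a s')
    (hQ : ∀ h, h < H → ∀ s a s', 0 ≤ Q h s a s')
    (hP1 : ∀ h, h < H → ∀ s a, ∑ s', P h s a s' = 1)
    (hQ1 : ∀ h, h < H → ∀ s a, ∑ s', Q h s a s' = 1)
    {f g : ∀ h, S h → A → ℝ} (hf : ∀ h s a, 0 ≤ f h s a ∧ f h s a ≤ 1)
    (hg : ∀ h s a, 0 ≤ g h s a ∧ g h s a ≤ 1) {br bp : ℝ} (hbr : 0 < br) (hbp : 0 < bp)
    (pol : ∀ h, S h → A) (I : Finset ℕ) (pols : ℕ → ∀ h, S h → A) (s0 : S 0) :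
    |val P f pol H 0 s0 - val Q g pol H 0 s0| ≤
      val Q (fun h s a =>
          min 1 ((br / 2) / (1 + ∑ i ∈ I, occ0 Q (pols i) s0 h s a)) +
          min (H : ℝ) ((bp * H / 2) / (1 + ∑ i ∈ I, occ0 Q (pols i) s0 h s a))) pol H 0 s0 +
        1 / (2 * br) * (H + 3 * ∑ i ∈ I, val P (fun h s a => (g h s a - f h s a) ^ 2)
            (pols i) H 0 s0 +
          6 * (H : ℝ) ^ 2 * ∑ i ∈ I, val P (fun h s a => hellingerSq (P h s a) (Q h s a))
            (pols i) H 0 s0) +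
        H / (2 * bp) * (2 * H + (3 + 12 * (H : ℝ) ^ 2) *
          ∑ i ∈ I, val P (fun h s a => hellingerSq (P h s a) (Q h s a)) (pols i) H 0 s0) := by
  have hH0 : (0 : ℝ) < H := by exact_mod_cast hH
  set w : ∀ h, S h → A → ℝ := fun h s a => 1 + ∑ i ∈ I, occ0 Q (pols i) s0 h s a with hw
  set d : ∀ h, S h → A → ℝ := fun h s a => hellingerSq (P h s a) (Q h s a) with hd
  set e : ∀ h, S h → A → ℝ := fun h s a => (g h s a - f h s a) ^ 2 with he
  have hd0 : ∀ h, h < H → ∀ s a, 0 ≤ d h s a := fun h _ s a => hellingerSq_nonneg _ _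
  have hd2 : ∀ h, h < H → ∀ s a, d h s a ≤ 2 := fun h hh s a =>
    hellingerSq_le_two (hP h hh s a) (hQ h hh s a) (hP1 h hh s a) (hQ1 h hh s a)
  have he0 : ∀ h, h < H → ∀ s a, 0 ≤ e h s a := fun h _ s a => sq_nonneg _
  have habs : ∀ h s a, |f h s a - g h s a| ≤ 1 := fun h s a => by
    rw [abs_le]
    constructor <;> linarith [(hf h s a).1, (hf h s a).2, (hg h s a).1, (hg h s a).2]
  have hesq : ∀ h s a, |f h s a - g h s a| ^ 2 = e h s a := fun h s a => by
    rw [sq_abs]; simp only [he]; ring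
  have he1 : ∀ h, h < H → ∀ s a, e h s a ≤ 1 := fun h _ s a => by
    rw [← hesq]; exact pow_le_one₀ (abs_nonneg _) (habs h s a)
  have hpoint : ∀ h, h < H → ∀ s a,
      |f h s a - g h s a| + H * min 1 (Real.sqrt (d h s a)) ≤
        ((min 1 ((br / 2) / w h s a) + min (H : ℝ) ((bp * H / 2) / w h s a)) +
          1 / (2 * br) * (w h s a * e h s a)) + H / (2 * bp) * (w h s a * d h s a) := by
    intro h hh s a
    have hN : 0 ≤ ∑ i ∈ I, occ0 Q (pols i) s0 h s a :=
      Finset.sum_nonneg fun i _ => occ0_nonneg hQ _ s0 h hh.le s a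
    have hwpos : 0 < w h s a := by simp only [hw]; linarith
    have h1 := le_min_one_add (habs h s a) hbr hwpos
    rw [hesq] at h1
    have h2 := le_min_one_add (min_le_left 1 (Real.sqrt (d h s a))) hbp hwpos
    have h3 : min 1 (Real.sqrt (d h s a)) ^ 2 ≤ d h s a := by
      calc _ ≤ Real.sqrt (d h s a) ^ 2 :=
            pow_le_pow_left₀ (le_min zero_le_one (Real.sqrt_nonneg _)) (min_le_right _ _) 2
        _ = _ := Real.sq_sqrt (hd0 h hh s a)
    have h4 : 1 / (2 * bp) * (w h s a * min 1 (Real.sqrt (d h s a)) ^ 2) ≤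
        1 / (2 * bp) * (w h s a * d h s a) := by gcongr
    have h5 := mul_le_mul_of_nonneg_left (h2.trans (add_le_add le_rfl h4)) hH0.le
    have h6 : (H : ℝ) * min 1 (bp / 2 / w h s a) = min (H : ℝ) ((bp * H / 2) / w h s a) := by
      rw [mul_min_of_nonneg _ _ hH0.le, mul_one]
      congr 1
      ring
    have h7 : (H : ℝ) * (1 / (2 * bp) * (w h s a * d h s a)) =
        H / (2 * bp) * (w h s a * d h s a) := by ring
    rw [mul_add, h6, h7] at h5
    linarith
  have hval := (abs_val_sub_val_le hP hQ hP1 hQ1 (g := g) hf pol H 0 s0 (by omega)).trans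
    (val_mono hQ hpoint pol H 0 s0 (by omega))
  rw [val_add, val_add, val_const_mul, val_const_mul] at hval
  have hE := val_one_add_sum_occ0_mul_le hQ hQ1 he0 he1 zero_le_one pol I pols s0
  have hD := val_one_add_sum_occ0_mul_le hQ hQ1 hd0 hd2 zero_le_two pol I pols s0
  have hE' : ∑ i ∈ I, val Q e (pols i) H 0 s0 ≤ 3 * ∑ i ∈ I, val P e (pols i) H 0 s0 +
      6 * (H : ℝ) ^ 2 * ∑ i ∈ I, val P d (pols i) H 0 s0 := by
    rw [Finset.mul_sum, Finset.mul_sum, ← Finset.sum_add_distrib]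
    refine Finset.sum_le_sum fun i _ => ?_
    have := val_le_three_mul_val_add hH hP hQ hP1 hQ1 he0 he1 zero_le_one (pols i) s0
    rwa [mul_one] at this
  have hD' : ∑ i ∈ I, val Q d (pols i) H 0 s0 ≤ (3 + 12 * (H : ℝ) ^ 2) *
      ∑ i ∈ I, val P d (pols i) H 0 s0 := by
    rw [Finset.mul_sum]
    refine Finset.sum_le_sum fun i _ => ?_
    have := val_le_three_mul_val_add hH hP hQ hP1 hQ1 hd0 hd2 zero_le_two (pols i) s0
    linarith
  refine hval.trans (add_le_add (add_le_add le_rfl ?_) ?_)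
  · refine mul_le_mul_of_nonneg_left ?_ (by positivity)
    linarith
  · refine mul_le_mul_of_nonneg_left ?_ (by positivity)
    linarith

end LayeredMDP

/-- High-probability confidence bound for the value approximation
(`corl:UCB-value-main`), conditioned on the cumulative approximation-error bounds. -/
theorem stmt10
    (H : ℕ) (hH : 1 ≤ H)
    (s0 : S 0) (hS0 : ∀ s : S 0, s = s0)
    (D : C → ℝ) (hD0 : ∀ c, 0 ≤ D c) (hD1 : (∑ c, D c) = 1)
    (T t : ℕ) (hT : 1 ≤ T) (ht : 1 ≤ t) (htT : t ≤ T)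
    (NF NP : ℕ) (hNF : 1 ≤ NF) (hNP : 1 ≤ NP)
    (del : ℝ) (hdel0 : 0 < del) (hdel1 : del < 1)
    (br bp : ℝ) (hbr : 0 < br) (hbp : 0 < bp)
    (fstar fhat : C → ∀ h, S h → A → ℝ)
    (hfstar : ∀ c h s a, 0 ≤ fstar c h s a ∧ fstar c h s a ≤ 1)
    (hfhat : ∀ c h s a, 0 ≤ fhat c h s a ∧ fhat c h s a ≤ 1)
    (Pstar Phat : C → ∀ h, S h → A → S (h + 1) → ℝ)
    (hPstar0 : ∀ c h, h < H → ∀ s a s', 0 ≤ Pstar c h s a s')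
    (hPstar1 : ∀ c h, h < H → ∀ s a, (∑ s', Pstar c h s a s') = 1)
    (hPhat0 : ∀ c h, h < H → ∀ s a s', 0 ≤ Phat c h s a s')
    (hPhat1 : ∀ c h, h < H → ∀ s a, (∑ s', Phat c h s a s') = 1)
    (pols : ℕ → C → ∀ h, S h → A)
    (hRewErr :
      (∑ c, D c * ∑ i ∈ Finset.range (t - 1), ∑ h ∈ Finset.range H,
          ∑ s : S h, ∑ a : A,
            occ0 (Pstar c) (pols i c) s0 h s a *
              (fhat c h s a - fstar c h s a) ^ 2) ≤
        68 * (H : ℝ) * Real.log (6 * (T : ℝ) ^ 3 * NF / del))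
    (hDynErr :
      (∑ c, D c * ∑ i ∈ Finset.range (t - 1), ∑ h ∈ Finset.range H,
          ∑ s : S h, ∑ a : A,
            occ0 (Pstar c) (pols i c) s0 h s a *
              hellingerSq (Pstar c h s a) (Phat c h s a)) ≤
        2 * (H : ℝ) * Real.log (3 * (T : ℝ) * H * NP / del)) :
    ∀ pol : C → ∀ h, S h → A,
      |∑ c, D c * (val (Pstar c) (fstar c) (pol c) H 0 s0 -
          val (Phat c) (fhat c) (pol c) H 0 s0)| ≤
        (112 * (H : ℝ) ^ 3 / br) *
            Real.log (18 * (T : ℝ) ^ 4 * H * NF * NP / del ^ 2) +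
          (157 * (H : ℝ) ^ 4 / bp) * Real.log (3 * (T : ℝ) * H * NP / del) +
          (∑ c, D c * ∑ h ∈ Finset.range H, ∑ s : S h, ∑ a : A,
            occ0 (Phat c) (pol c) s0 h s a *
              (bonusR Phat pols s0 t br c h s a +
                bonusP Phat pols s0 t bp H c h s a)) := by
  intro pol
  have hH1 : (1 : ℝ) ≤ H := by exact_mod_cast hH
  have hT1 : (1 : ℝ) ≤ T := by exact_mod_cast hT
  have hNF1 : (1 : ℝ) ≤ NF := by exact_mod_cast hNF
  have hNP1 : (1 : ℝ) ≤ NP := by exact_mod_cast hNP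
  simp only [sum_occ0_mul_eq_val] at hRewErr hDynErr ⊢
  set L₁ := Real.log (6 * (T : ℝ) ^ 3 * NF / del) with hL₁
  set L₂ := Real.log (3 * (T : ℝ) * H * NP / del) with hL₂
  have hlog : Real.log (18 * (T : ℝ) ^ 4 * H * NF * NP / del ^ 2) = L₁ + L₂ := by
    rw [hL₁, hL₂, ← Real.log_mul (by positivity) (by positivity)]
    congr 1
    field_simp
    ring
  have hL₁0 : 0 ≤ L₁ := by
    refine Real.log_nonneg ?_
    rw [le_div_iff₀ hdel0]
    have : (1 : ℝ) ≤ (T : ℝ) ^ 3 * NF := one_le_mul_of_one_le_of_one_le (one_le_pow₀ hT1) hNF1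
    linarith
  have hL₂1 : 1 ≤ L₂ := by
    rw [hL₂, Real.le_log_iff_exp_le (by positivity), le_div_iff₀ hdel0]
    have h1 : (1 : ℝ) ≤ T * H * NP :=
      one_le_mul_of_one_le_of_one_le (one_le_mul_of_one_le_of_one_le hT1 hH1) hNP1
    nlinarith [Real.exp_one_lt_d9, Real.exp_pos 1]
  set E : C → ℝ := fun c => ∑ i ∈ Finset.range (t - 1),
    val (Pstar c) (fun h s a => (fhat c h s a - fstar c h s a) ^ 2) (pols i c) H 0 s0 with hE
  set F : C → ℝ := fun c => ∑ i ∈ Finset.range (t - 1),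
    val (Pstar c) (fun h s a => hellingerSq (Pstar c h s a) (Phat c h s a)) (pols i c) H 0 s0
    with hF
  set b : C → ℝ := fun c => val (Phat c) (fun h s a => bonusR Phat pols s0 t br c h s a +
    bonusP Phat pols s0 t bp H c h s a) (pol c) H 0 s0 with hb
  have hctx : ∀ c, |val (Pstar c) (fstar c) (pol c) H 0 s0 -
      val (Phat c) (fhat c) (pol c) H 0 s0| ≤
      b c + 1 / (2 * br) * (H + 3 * E c + 6 * (H : ℝ) ^ 2 * F c) +
        H / (2 * bp) * (2 * H + (3 + 12 * (H : ℝ) ^ 2) * F c) := fun c =>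
    abs_val_sub_val_le_bonus hH (hPstar0 c) (hPhat0 c) (hPstar1 c) (hPhat1 c) (hfstar c)
      (hfhat c) hbr hbp (pol c) (Finset.range (t - 1)) (fun i => pols i c) s0
  have hsum : |∑ c, D c * (val (Pstar c) (fstar c) (pol c) H 0 s0 -
      val (Phat c) (fhat c) (pol c) H 0 s0)| ≤
      ∑ c, D c * b c + 1 / (2 * br) * (H + 3 * ∑ c, D c * E c +
          6 * (H : ℝ) ^ 2 * ∑ c, D c * F c) +
        H / (2 * bp) * (2 * H + (3 + 12 * (H : ℝ) ^ 2) * ∑ c, D c * F c) := by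
    calc _ ≤ ∑ c, D c * (b c + 1 / (2 * br) * (H + 3 * E c + 6 * (H : ℝ) ^ 2 * F c) +
          H / (2 * bp) * (2 * H + (3 + 12 * (H : ℝ) ^ 2) * F c)) := by
          refine (Finset.abs_sum_le_sum_abs _ _).trans (Finset.sum_le_sum fun c _ => ?_)
          rw [abs_mul, abs_of_nonneg (hD0 c)]
          exact mul_le_mul_of_nonneg_left (hctx c) (hD0 c)
      _ = ∑ c, (D c * b c + (1 / (2 * br) * H + H / (2 * bp) * (2 * H)) * D c +
            1 / (2 * br) * 3 * (D c * E c) +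
            (1 / (2 * br) * (6 * (H : ℝ) ^ 2) + H / (2 * bp) * (3 + 12 * (H : ℝ) ^ 2)) *
              (D c * F c)) := Finset.sum_congr rfl fun c _ => by ring
      _ = _ := by
          simp only [Finset.sum_add_distrib, ← Finset.mul_sum, hD1]
          ring
  have hR : 1 / (2 * br) * (H + 3 * ∑ c, D c * E c + 6 * (H : ℝ) ^ 2 * ∑ c, D c * F c) ≤
      112 * (H : ℝ) ^ 3 / br * (L₁ + L₂) := by
    have hH3 : (H : ℝ) ≤ (H : ℝ) ^ 3 := le_self_pow₀ hH1 (by norm_num)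
    have h1 := mul_le_mul_of_nonneg_left hDynErr (by positivity : 0 ≤ 6 * (H : ℝ) ^ 2)
    have h2 := mul_le_mul_of_nonneg_right hH3 hL₁0
    have h3 := mul_le_mul_of_nonneg_left hL₂1 (by positivity : 0 ≤ (H : ℝ) ^ 3)
    have h4 : 0 ≤ (H : ℝ) ^ 3 * L₁ := by positivity
    calc _ ≤ 1 / (2 * br) * (224 * (H : ℝ) ^ 3 * (L₁ + L₂)) := by
          refine mul_le_mul_of_nonneg_left ?_ (by positivity)
          linarith
      _ = _ := by field_simp; ring
  have hP : H / (2 * bp) * (2 * H + (3 + 12 * (H : ℝ) ^ 2) * ∑ c, D c * F c) ≤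
      157 * (H : ℝ) ^ 4 / bp * L₂ := by
    have hH3 : (H : ℝ) ≤ (H : ℝ) ^ 3 := le_self_pow₀ hH1 (by norm_num)
    have h1 := mul_le_mul_of_nonneg_left hDynErr (by positivity : 0 ≤ 3 + 12 * (H : ℝ) ^ 2)
    have h2 := mul_le_mul_of_nonneg_right hH3 (by linarith : 0 ≤ L₂)
    have h3 := mul_le_mul_of_nonneg_left hL₂1 (by positivity : 0 ≤ (H : ℝ) ^ 3)
    calc _ ≤ H / (2 * bp) * (314 * (H : ℝ) ^ 3 * L₂) := by
          refine mul_le_mul_of_nonneg_left ?_ (by positivity)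
          linarith
      _ = _ := by field_simp; ring
  rw [hlog]
  linarith

end
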